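/- Explicit correlations of the optimal star state: Let n ≥ 2, t ∈ [0, π/4], α = √((1 + √2 sin t)/2), β = √((1 − √2 sin t)/2), and let |ψ⟩ = (α|00⟩ + β|11⟩) ⊗ |0⟩^{⊗(n−1)} be the (n+1)-qubit pure state in which qubits 1 and 2 are in the state α|00⟩ + β|11⟩ and qubits 3,…,n+1 are in state |0⟩, with ρ = |ψ⟩⟨ψ|. Then Σ_{k,l ∈ {x,z}} (Tr(ρ σ_k^{(1)} σ_l^{(2)}))² = 2 cos² t, and for every j ∈ {3,…,n+1}, Σ_{k,l ∈ {x,z}} (Tr(ρ σ_k^{(1)} σ_l^{(j)}))² = 2 sin² t; in particular every relation (2cos²t) + (2sin²t) ≤ 2 between the pair (1,2) and a pair (1,j) is saturated. -/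

import Mathlib

open Matrix Complex ComplexOrder

noncomputable section

/-- The Pauli X matrix. -/
def pX : Matrix (Fin 2) (Fin 2) ℂ := !![0, 1; 1, 0]

/-- The Pauli Y matrix. -/
def pY : Matrix (Fin 2) (Fin 2) ℂ := !![0, -Complex.I; Complex.I, 0]

/-- The Pauli Z matrix. -/
def pZ : Matrix (Fin 2) (Fin 2) ℂ := !![1, 0; 0, -1]

/-- The operator on `n` qubits acting as the single-qubit operator `M` on qubit `i`
and as the identity on all other qubits. -/
def onQubit {n : ℕ} (M : Matrix (Fin 2) (Fin 2) ℂ) (i : Fin n) :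
    Matrix (Fin n → Fin 2) (Fin n → Fin 2) ℂ :=
  Matrix.of fun a b => ∏ s, if s = i then M (a s) (b s) else (if a s = b s then 1 else 0)

/-- An `n`-qubit density matrix: positive semidefinite with unit trace. -/
def IsDensityMatrix {n : ℕ} (ρ : Matrix (Fin n → Fin 2) (Fin n → Fin 2) ℂ) : Prop :=
  ρ.PosSemidef ∧ ρ.trace = 1

/-- The two Pauli matrices spanning the xy plane. -/
def XY : Fin 2 → Matrix (Fin 2) (Fin 2) ℂ := ![pX, pY]

/-- The two Pauli matrices spanning the xz plane. -/
def XZ : Fin 2 → Matrix (Fin 2) (Fin 2) ℂ := ![pX, pZ]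

/-- The xy-plane Bell strength 𝒯²_{ij}(ρ) of the pair of qubits (i,j). -/
def T2pair {n : ℕ} (ρ : Matrix (Fin n → Fin 2) (Fin n → Fin 2) ℂ) (i j : Fin n) : ℝ :=
  ∑ k : Fin 2, ∑ l : Fin 2,
    ((ρ * (onQubit (XY k) i * onQubit (XY l) j)).trace.re) ^ 2

/-- The xy-plane Bell strength 𝒯²_{ijm}(ρ) of the triple of qubits (i,j,m). -/
def T2triple {n : ℕ} (ρ : Matrix (Fin n → Fin 2) (Fin n → Fin 2) ℂ) (i j m : Fin n) : ℝ :=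
  ∑ k : Fin 2, ∑ l : Fin 2, ∑ p : Fin 2,
    ((ρ * (onQubit (XY k) i * onQubit (XY l) j * onQubit (XY p) m)).trace.re) ^ 2

/-- The xy-plane Bell strength 𝒯²_{ijml}(ρ) of the quadruple of qubits (i,j,m,l). -/
def T2quad {n : ℕ} (ρ : Matrix (Fin n → Fin 2) (Fin n → Fin 2) ℂ) (i j m l : Fin n) : ℝ :=
  ∑ k : Fin 2, ∑ k' : Fin 2, ∑ k'' : Fin 2, ∑ k''' : Fin 2,
    ((ρ * (onQubit (XY k) i * onQubit (XY k') j * onQubit (XY k'') m *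
        onQubit (XY k''') l)).trace.re) ^ 2

/-- The xz-plane Bell strength of the pair of qubits (i,j). -/
def T2pairXZ {n : ℕ} (ρ : Matrix (Fin n → Fin 2) (Fin n → Fin 2) ℂ) (i j : Fin n) : ℝ :=
  ∑ k : Fin 2, ∑ l : Fin 2,
    ((ρ * (onQubit (XZ k) i * onQubit (XZ l) j)).trace.re) ^ 2

/-- The (n+1)-qubit vector (α|00⟩ + β|11⟩) ⊗ |0⟩^{⊗(n−1)}, with
α = √((1 + √2 sin t)/2), β = √((1 − √2 sin t)/2), qubits here 0-indexed: qubits 0 and 1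
carry α|00⟩ + β|11⟩ and all qubits j with j ≥ 2 are in |0⟩. -/
def starVec (n : ℕ) (t : ℝ) : (Fin (n + 1) → Fin 2) → ℂ := fun a =>
  (if a 0 = 0 ∧ a 1 = 0 then ((Real.sqrt ((1 + Real.sqrt 2 * Real.sin t) / 2) : ℝ) : ℂ)
   else if a 0 = 1 ∧ a 1 = 1 then ((Real.sqrt ((1 - Real.sqrt 2 * Real.sin t) / 2) : ℝ) : ℂ)
   else 0) *
  ∏ s : Fin (n + 1), (if 2 ≤ (s : ℕ) ∧ a s ≠ 0 then 0 else 1)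

/-- The corresponding pure density matrix ρ = |ψ⟩⟨ψ|. -/
def starRho (n : ℕ) (t : ℝ) : Matrix (Fin (n + 1) → Fin 2) (Fin (n + 1) → Fin 2) ℂ :=
  Matrix.of fun a b => starVec n t a * (starRingEnd ℂ) (starVec n t b)

/-- The computational basis label with ones on the qubits `0` and `1` and zeros elsewhere. -/
def firstPairOnes (n : ℕ) : Fin (n + 1) → Fin 2 := fun s => if (s : ℕ) < 2 then 1 else 0

lemma onQubit_mul_onQubit_apply {n : ℕ} (A B : Matrix (Fin 2) (Fin 2) ℂ) {i j : Fin n}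
    (hij : i ≠ j) (a b : Fin n → Fin 2) :
    (onQubit A i * onQubit B j) a b =
      A (a i) (b i) * B (a j) (b j) * if ∀ s, s ≠ i → s ≠ j → a s = b s then 1 else 0 := by
  have entry : (onQubit A i * onQubit B j) a b =
      ∏ s, if s = i then A (a s) (b s) else if s = j then B (a s) (b s) else
        if a s = b s then 1 else 0 := by
    simp only [Matrix.mul_apply, onQubit, Matrix.of_apply, ← Finset.prod_mul_distrib]
    rw [← Fintype.prod_sum fun s x => (if s = i then A (a s) x else if a s = x then 1 else 0) *
      (if s = j then B x (b s) else if x = b s then 1 else 0)]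
    refine Finset.prod_congr rfl fun s _ => ?_
    by_cases hi : s = i
    · subst hi
      simp [hij]
    · simp [hi]
  rw [entry, ← Finset.mul_prod_erase _ _ (Finset.mem_univ i),
    ← Finset.mul_prod_erase _ _ (Finset.mem_erase.2 ⟨hij.symm, Finset.mem_univ j⟩),
    if_pos rfl, if_neg hij.symm, if_pos rfl, ← mul_assoc]
  congr 1
  split_ifs with h
  · refine Finset.prod_eq_one fun s hs => ?_
    simp only [Finset.mem_erase, Finset.mem_univ, and_true] at hs
    simp [hs.1, hs.2, h s hs.2 hs.1]
  · push Not at h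
    obtain ⟨s, hi, hj, hs⟩ := h
    exact Finset.prod_eq_zero (i := s) (by simp [hi, hj]) (by simp [hi, hj, hs])

lemma starVec_eq_single_add_single {n : ℕ} (hn : 2 ≤ n) (t : ℝ) :
    starVec n t =
      Pi.single 0 ((√((1 + √2 * Real.sin t) / 2) : ℝ) : ℂ) +
      Pi.single (firstPairOnes n) ((√((1 - √2 * Real.sin t) / 2) : ℝ) : ℂ) := by
  obtain ⟨m, rfl⟩ := Nat.exists_eq_add_of_le' hn
  funext a
  have h0 : a = 0 ↔ (a 0 = 0 ∧ a 1 = 0) ∧ ∀ s : Fin (m + 2 + 1), 2 ≤ (s : ℕ) → a s = 0 := by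
    constructor
    · rintro rfl
      simp
    · rintro ⟨⟨h, h'⟩, hs⟩
      funext s
      induction s using Fin.cases with
      | zero => exact h
      | succ s =>
        induction s using Fin.cases with
        | zero => exact h'
        | succ s => exact hs _ (by simp)
  have h1 : a = firstPairOnes (m + 2) ↔
      (a 0 = 1 ∧ a 1 = 1) ∧ ∀ s : Fin (m + 2 + 1), 2 ≤ (s : ℕ) → a s = 0 := by
    constructor
    · rintro rfl
      refine ⟨by simp [firstPairOnes], fun s hs => ?_⟩
      simp [firstPairOnes, hs.not_gt]
    · rintro ⟨⟨h, h'⟩, hs⟩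
      funext s
      induction s using Fin.cases with
      | zero => simpa [firstPairOnes] using h
      | succ s =>
        induction s using Fin.cases with
        | zero => simpa [firstPairOnes] using h'
        | succ s => simpa [firstPairOnes] using hs s.succ.succ (by simp)
  have hprod : (∏ s : Fin (m + 2 + 1), if 2 ≤ (s : ℕ) ∧ a s ≠ 0 then (0 : ℂ) else 1) =
      if ∀ s : Fin (m + 2 + 1), 2 ≤ (s : ℕ) → a s = 0 then 1 else 0 := by
    split_ifs with h
    · exact Finset.prod_eq_one fun s _ => if_neg fun hs => hs.2 (h s hs.1)
    · push Not at h
      obtain ⟨s, hs⟩ := h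
      exact Finset.prod_eq_zero (Finset.mem_univ s) (if_pos hs)
  rw [starVec, hprod, Pi.add_apply, Pi.single_apply, Pi.single_apply]
  simp only [h0, h1]
  by_cases hz : a 0 = 0 ∧ a 1 = 0
  · simp [hz]
  · by_cases ho : a 0 = 1 ∧ a 1 = 1 <;> simp [hz, ho]

lemma trace_starRho_mul {n : ℕ} (hn : 2 ≤ n) (t : ℝ)
    (M : Matrix (Fin (n + 1) → Fin 2) (Fin (n + 1) → Fin 2) ℂ) :
    (starRho n t * M).trace =
      (√((1 + √2 * Real.sin t) / 2) : ℂ) ^ 2 * M 0 0 +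
      (√((1 - √2 * Real.sin t) / 2) : ℂ) ^ 2 * M (firstPairOnes n) (firstPairOnes n) +
      (√((1 + √2 * Real.sin t) / 2) : ℂ) * (√((1 - √2 * Real.sin t) / 2) : ℂ) *
        (M 0 (firstPairOnes n) + M (firstPairOnes n) 0) := by
  have hρ : starRho n t = Matrix.vecMulVec (starVec n t) (star (starVec n t)) := rfl
  rw [hρ, Matrix.vecMulVec_mul, Matrix.trace_vecMulVec, starVec_eq_single_add_single hn,
    star_add, Pi.star_single, Pi.star_single, Matrix.add_vecMul, Matrix.single_vecMul,
    Matrix.single_vecMul]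
  simp [add_dotProduct, mul_add]
  ring

lemma sq_sqrt_two_mul_sin_le_one {t : ℝ} (ht0 : 0 ≤ t) (ht1 : t ≤ Real.pi / 4) :
    (√2 * Real.sin t) ^ 2 ≤ 1 := by
  have h : 0 ≤ Real.cos (2 * t) :=
    Real.cos_nonneg_of_mem_Icc ⟨by linarith [Real.pi_pos], by linarith⟩
  rw [Real.cos_two_mul, Real.cos_sq'] at h
  rw [mul_pow, Real.sq_sqrt zero_le_two]
  linarith

lemma T2pairXZ_starRho_zero_one {n : ℕ} (hn : 2 ≤ n) {t : ℝ} (ht : (√2 * Real.sin t) ^ 2 ≤ 1) :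
    T2pairXZ (starRho n t) 0 1 = 2 * Real.cos t ^ 2 := by
  obtain ⟨m, rfl⟩ := Nat.exists_eq_add_of_le' hn
  obtain ⟨hl, hr⟩ := abs_le.1 ((sq_le_one_iff_abs_le_one _).1 ht)
  have hα := Real.sq_sqrt (show 0 ≤ (1 + √2 * Real.sin t) / 2 by linarith)
  have hβ := Real.sq_sqrt (show 0 ≤ (1 - √2 * Real.sin t) / 2 by linarith)
  have hagree : ∀ s : Fin (m + 2 + 1), s ≠ 0 → s ≠ 1 → firstPairOnes (m + 2) s = 0 := by
    intro s h0 h1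
    have : ¬ (s : ℕ) < 2 := by
      simp only [ne_eq, Fin.ext_iff, Fin.val_zero, Fin.val_one] at h0 h1
      omega
    simp [firstPairOnes, this]
  have hagree' : ∀ s : Fin (m + 2 + 1), s ≠ 0 → s ≠ 1 → 0 = firstPairOnes (m + 2) s :=
    fun s h0 h1 => (hagree s h0 h1).symm
  have hv0 : firstPairOnes (m + 2) 0 = 1 := by simp [firstPairOnes]
  have hv1 : firstPairOnes (m + 2) 1 = 1 := by simp [firstPairOnes]
  have h01 : (0 : Fin (m + 2 + 1)) ≠ 1 := by simp
  simp only [T2pairXZ, Fin.sum_univ_two, trace_starRho_mul hn, onQubit_mul_onQubit_apply _ _ h01,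
    Pi.zero_apply, hv0, hv1, if_pos hagree, if_pos hagree']
  generalize √((1 + √2 * Real.sin t) / 2) = α at *
  generalize √((1 - √2 * Real.sin t) / 2) = β at *
  have hsq := Real.sq_sqrt (zero_le_two (α := ℝ))
  simp [XZ, pX, pZ, ← Complex.ofReal_pow, Real.cos_sq']
  rw [hα, hβ]
  linear_combination 4 * β ^ 2 * hα + 2 * (1 + √2 * Real.sin t) * hβ - Real.sin t ^ 2 * hsq

lemma T2pairXZ_starRho_zero_of_two_le {n : ℕ} (hn : 2 ≤ n) {t : ℝ}
    (ht : (√2 * Real.sin t) ^ 2 ≤ 1) {j : Fin (n + 1)} (hj : 2 ≤ (j : ℕ)) :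
    T2pairXZ (starRho n t) 0 j = 2 * Real.sin t ^ 2 := by
  obtain ⟨m, rfl⟩ := Nat.exists_eq_add_of_le' hn
  obtain ⟨hl, hr⟩ := abs_le.1 ((sq_le_one_iff_abs_le_one _).1 ht)
  have hα := Real.sq_sqrt (show 0 ≤ (1 + √2 * Real.sin t) / 2 by linarith)
  have hβ := Real.sq_sqrt (show 0 ≤ (1 - √2 * Real.sin t) / 2 by linarith)
  have hv0 : firstPairOnes (m + 2) 0 = 1 := by simp [firstPairOnes]
  have hv1 : firstPairOnes (m + 2) 1 = 1 := by simp [firstPairOnes]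
  have hvj : firstPairOnes (m + 2) j = 0 := by simp [firstPairOnes, hj.not_gt]
  have h0j : 0 ≠ j := by
    rintro rfl
    simp at hj
  have h1j : 1 ≠ j := by
    rintro rfl
    simp at hj
  have hdiffer : ¬ ∀ s : Fin (m + 2 + 1), s ≠ 0 → s ≠ j → firstPairOnes (m + 2) s = 0 :=
    fun h => by simpa [hv1] using h 1 (by simp) h1j
  have hdiffer' : ¬ ∀ s : Fin (m + 2 + 1), s ≠ 0 → s ≠ j → 0 = firstPairOnes (m + 2) s :=
    fun h => by simpa [hv1] using h 1 (by simp) h1j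
  simp only [T2pairXZ, Fin.sum_univ_two, trace_starRho_mul hn, onQubit_mul_onQubit_apply _ _ h0j,
    Pi.zero_apply, hv0, hvj, if_neg hdiffer, if_neg hdiffer']
  generalize √((1 + √2 * Real.sin t) / 2) = α at *
  generalize √((1 - √2 * Real.sin t) / 2) = β at *
  have hsq := Real.sq_sqrt (zero_le_two (α := ℝ))
  simp [XZ, pX, pZ, ← Complex.ofReal_pow]
  rw [hα, hβ]
  linear_combination Real.sin t ^ 2 * hsq

/-- **Explicit correlations of the optimal star state.** For the state
|ψ⟩ = (α|00⟩ + β|11⟩) ⊗ |0⟩^{⊗(n−1)} with t ∈ [0, π/4], the xz-plane Bell strength of the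
pair (1,2) (0-indexed (0,1)) is 2cos²t and that of every pair (1,j), j ≥ 3 (0-indexed
(0,j), j ≥ 2) is 2sin²t; in particular every relation 𝒯²₁₂ + 𝒯²₁ⱼ ≤ 2 is saturated. -/
theorem star_state_correlations (n : ℕ) (hn : 2 ≤ n) (t : ℝ)
    (ht0 : 0 ≤ t) (ht1 : t ≤ Real.pi / 4) :
    T2pairXZ (starRho n t) 0 1 = 2 * Real.cos t ^ 2 ∧
    (∀ j : Fin (n + 1), 2 ≤ (j : ℕ) → T2pairXZ (starRho n t) 0 j = 2 * Real.sin t ^ 2) ∧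
    (∀ j : Fin (n + 1), 2 ≤ (j : ℕ) →
      T2pairXZ (starRho n t) 0 1 + T2pairXZ (starRho n t) 0 j = 2) := by
  have ht := sq_sqrt_two_mul_sin_le_one ht0 ht1
  refine ⟨T2pairXZ_starRho_zero_one hn ht, fun j hj => T2pairXZ_starRho_zero_of_two_le hn ht hj,
    fun j hj => ?_⟩
  rw [T2pairXZ_starRho_zero_one hn ht, T2pairXZ_starRho_zero_of_two_le hn ht hj, ← mul_add,
    Real.cos_sq_add_sin_sq, mul_one]
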